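/- Let (Ω, 𝔽, P) be a probability space carrying independent real random variables F and C, where F has law N(μ_f, σ_f²) and C has law N(μ_c, σ_c²), with σ_f > 0 and σ_c > 0, and let f⁺ ∈ ℝ. Then the expected constrained improvement satisfies E[1_{C ≥ 0} · max(f⁺ − F, 0)] = Φ(μ_c/σ_c) · [(f⁺ − μ_f)·Φ(Z_f) + σ_f·φ(Z_f)], where Z_f = (f⁺ − μ_f)/σ_f; that is, EI_C(x) = PF(x)·EI(x) with PF(x) = P(C ≥ 0) = Φ(μ_c/σ_c). -/

import Mathlib

open MeasureTheory ProbabilityTheory Real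

/-- The density of the standard normal distribution on `ℝ`. -/
noncomputable def stdNormalPDF (z : ℝ) : ℝ :=
  (Real.sqrt (2 * Real.pi))⁻¹ * Real.exp (-z ^ 2 / 2)

/-- The cumulative distribution function of the standard normal distribution. -/
noncomputable def stdNormalCDF (t : ℝ) : ℝ :=
  ∫ z in Set.Iic t, stdNormalPDF z

lemma stdNormalPDF_eq_gaussianPDFReal : stdNormalPDF = gaussianPDFReal 0 1 := by
  ext z
  simp [stdNormalPDF, gaussianPDFReal]

lemma integrable_stdNormalPDF : Integrable stdNormalPDF :=
  stdNormalPDF_eq_gaussianPDFReal ▸ integrable_gaussianPDFReal 0 1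

lemma hasDerivAt_stdNormalPDF (z : ℝ) : HasDerivAt stdNormalPDF (-(z * stdNormalPDF z)) z := by
  have h : HasDerivAt (fun z : ℝ => -z ^ 2 / 2) (-z) z := by
    refine ((hasDerivAt_pow 2 z).fun_neg.div_const 2).congr_deriv ?_
    norm_num
    ring
  refine (h.exp.const_mul (Real.sqrt (2 * Real.pi))⁻¹).congr_deriv ?_
  simp only [stdNormalPDF]
  ring

lemma integrable_mul_stdNormalPDF : Integrable (fun z => z * stdNormalPDF z) := by
  convert (integrable_mul_exp_neg_mul_sq (b := 1 / 2) (by norm_num)).const_mul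
    (Real.sqrt (2 * Real.pi))⁻¹ using 2 with z
  rw [stdNormalPDF, show -z ^ 2 / 2 = -(1 / 2) * z ^ 2 by ring]
  ring

lemma tendsto_stdNormalPDF_atBot : Filter.Tendsto stdNormalPDF Filter.atBot (nhds 0) :=
  tendsto_zero_of_hasDerivAt_of_integrableOn_Iic (a := 0)
    (fun z _ => hasDerivAt_stdNormalPDF z) integrable_mul_stdNormalPDF.neg.integrableOn
    integrable_stdNormalPDF.integrableOn

lemma integral_Iic_mul_stdNormalPDF (t : ℝ) :
    ∫ z in Set.Iic t, z * stdNormalPDF z = -stdNormalPDF t := by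
  have h := integral_Iic_of_hasDerivAt_of_tendsto' (a := t)
    (fun z _ => hasDerivAt_stdNormalPDF z) integrable_mul_stdNormalPDF.neg.integrableOn
    tendsto_stdNormalPDF_atBot
  rw [integral_neg, sub_zero] at h
  linarith

/-- Integrals against `N(μ, σ²)` after standardization; the sign of `σ` is arbitrary. -/
lemma integral_gaussianReal_eq_integral_stdNormalPDF (μ σ : ℝ) {g : ℝ → ℝ} (hg : Measurable g) :
    ∫ x, g x ∂gaussianReal μ (⟨σ ^ 2, sq_nonneg σ⟩ : NNReal) =
      ∫ z, stdNormalPDF z * g (μ + σ * z) := by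
  have hmap : (gaussianReal 0 1).map (fun z => μ + σ * z) =
      gaussianReal μ (⟨σ ^ 2, sq_nonneg σ⟩ : NNReal) := by
    rw [← Function.comp_def (fun x => μ + x) (fun z => σ * z),
      ← Measure.map_map (by fun_prop) (by fun_prop), gaussianReal_map_const_mul,
      gaussianReal_map_const_add, mul_zero, zero_add, mul_one]
    rfl
  rw [← hmap, integral_map (by fun_prop) hg.aestronglyMeasurable,
    integral_gaussianReal_eq_integral_smul one_ne_zero, stdNormalPDF_eq_gaussianPDFReal]
  rfl

/-- The probability of feasibility. -/
lemma integral_indicator_Ici_gaussianReal (μ : ℝ) {σ : ℝ} (hσ : 0 < σ) :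
    ∫ x, (Set.Ici (0 : ℝ)).indicator (fun _ => (1 : ℝ)) x
        ∂gaussianReal μ (⟨σ ^ 2, sq_nonneg σ⟩ : NNReal) = stdNormalCDF (μ / σ) := by
  have hv : (⟨σ ^ 2, sq_nonneg σ⟩ : NNReal) = ⟨(-σ) ^ 2, sq_nonneg (-σ)⟩ := by
    simp
  rw [hv, integral_gaussianReal_eq_integral_stdNormalPDF μ (-σ)
    (measurable_const.indicator measurableSet_Ici), stdNormalCDF,
    ← integral_indicator measurableSet_Iic]
  congr 1 with z
  have hz : 0 ≤ μ + -σ * z ↔ z ≤ μ / σ := by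
    rw [le_div_iff₀ hσ]
    constructor <;> intro h <;> linarith
  simp only [Set.indicator_apply, Set.mem_Ici, Set.mem_Iic, hz, mul_ite, mul_one, mul_zero]

/-- The unconstrained expected improvement. -/
lemma integral_max_sub_gaussianReal (μ : ℝ) {σ : ℝ} (hσ : 0 < σ) (a : ℝ) :
    ∫ x, max (a - x) 0 ∂gaussianReal μ (⟨σ ^ 2, sq_nonneg σ⟩ : NNReal) =
      (a - μ) * stdNormalCDF ((a - μ) / σ) + σ * stdNormalPDF ((a - μ) / σ) := by
  rw [integral_gaussianReal_eq_integral_stdNormalPDF μ σ (by fun_prop)]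
  have h (z : ℝ) : stdNormalPDF z * max (a - (μ + σ * z)) 0 =
      (Set.Iic ((a - μ) / σ)).indicator
        (fun z => (a - μ) * stdNormalPDF z - σ * (z * stdNormalPDF z)) z := by
    have hz : z ≤ (a - μ) / σ ↔ 0 ≤ a - (μ + σ * z) := by
      rw [le_div_iff₀ hσ]
      constructor <;> intro h <;> linarith
    simp only [Set.indicator_apply, Set.mem_Iic, hz]
    split_ifs with h0
    · rw [max_eq_left h0]
      ring
    · rw [max_eq_right (not_le.mp h0).le, mul_zero]
  simp_rw [h]
  rw [integral_indicator measurableSet_Iic,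
    integral_sub (integrable_stdNormalPDF.const_mul _).integrableOn
      (integrable_mul_stdNormalPDF.const_mul _).integrableOn,
    integral_const_mul, integral_const_mul, integral_Iic_mul_stdNormalPDF, stdNormalCDF]
  ring

/-- Closed form of the expected constrained improvement: `EI_C = PF · EI`. -/
theorem expected_constrained_improvement_closed_form
    {Ω : Type*} [MeasurableSpace Ω] (P : Measure Ω) [IsProbabilityMeasure P]
    (F C : Ω → ℝ) (hF : Measurable F) (hC : Measurable C)
    (hindep : IndepFun F C P)
    (μf σf μc σc : ℝ) (hσf : 0 < σf) (hσc : 0 < σc)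
    (hlawF : P.map F = gaussianReal μf (⟨σf ^ 2, sq_nonneg σf⟩ : NNReal))
    (hlawC : P.map C = gaussianReal μc (⟨σc ^ 2, sq_nonneg σc⟩ : NNReal))
    (fplus : ℝ) :
    ∫ ω, ({ω | 0 ≤ C ω}.indicator (fun ω => max (fplus - F ω) 0) ω) ∂P =
      stdNormalCDF (μc / σc) *
        ((fplus - μf) * stdNormalCDF ((fplus - μf) / σf)
          + σf * stdNormalPDF ((fplus - μf) / σf)) := by
  have hmeas : Measurable ((Set.Ici (0 : ℝ)).indicator (fun _ => (1 : ℝ))) :=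
    measurable_const.indicator measurableSet_Ici
  have hmax : Measurable (fun x : ℝ => max (fplus - x) 0) := by fun_prop
  have hprod (ω : Ω) : {ω | 0 ≤ C ω}.indicator (fun ω => max (fplus - F ω) 0) ω =
      (Set.Ici (0 : ℝ)).indicator (fun _ => (1 : ℝ)) (C ω) * max (fplus - F ω) 0 := by
    simp [Set.indicator_apply]
  simp_rw [hprod]
  rw [← integral_indicator_Ici_gaussianReal μc hσc, ← integral_max_sub_gaussianReal μf hσf fplus,
    ← hlawC, ← hlawF, integral_map hC.aemeasurable hmeas.aestronglyMeasurable,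
    integral_map hF.aemeasurable hmax.aestronglyMeasurable]
  exact (hindep.symm.comp hmeas hmax).integral_fun_mul_eq_mul_integral
    (hmeas.comp hC).aestronglyMeasurable (hmax.comp hF).aestronglyMeasurable
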